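/- There exists a constant C > 0 such that for all N ≥ 1, all s with 0 ≤ s < 1, all n, p ∈ ℕ, and all l = (l_1, …, l_N) ∈ ℕ^N with p + l_1 + ⋯ + l_N = n and l_j ≥ 2 for at least one index j, one has g(l, s, N) ≤ C · N² · (1−s)³ / (1−s)^{2n−2p}. -/

import Mathlib

open MeasureTheory Real Filter

noncomputable section

/-- The joint eigenangle density of `SO(2N+1)` on `[0,π]^N`. -/
def densitySO (N : ℕ) (θ : Fin N → ℝ) : ℝ :=
  (2 ^ (N ^ 2) / (π ^ N * N.factorial)) *
    (∏ j : Fin N, ∏ k ∈ Finset.Ioi j, (Real.cos (θ k) - Real.cos (θ j)) ^ 2) *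
    ∏ m : Fin N, Real.sin (θ m / 2) ^ 2

/-- `h(n, s, N)`: the `n`-th moment of the eigenvalue sum against the eigenangle density. -/
def hFun (n : ℕ) (s : ℝ) (N : ℕ) : ℝ :=
  ∫ θ in Set.univ.pi fun _ : Fin N => Set.Icc (0 : ℝ) π,
    ((s - 1) * ∑ j, (2 * s - 2 * Real.cos (θ j)) / (1 + s ^ 2 - 2 * s * Real.cos (θ j))) ^ n *
      densitySO N θ

/-- `g(l, s, N)`: the integral of `∏_j ((1-s)² + 4s sin²(θ_j/2))^{-l_j}` against the
eigenangle density. -/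
def gFun (N : ℕ) (l : Fin N → ℕ) (s : ℝ) : ℝ :=
  ∫ θ in Set.univ.pi fun _ : Fin N => Set.Icc (0 : ℝ) π,
    (∏ j, ((1 - s) ^ 2 + 4 * s * Real.sin (θ j / 2) ^ 2) ^ (-(l j : ℤ))) * densitySO N θ

open Polynomial in
/-- `sin ((j + 1/2) θ) / sin (θ / 2)` is `2 ^ j` times a monic polynomial of degree `j` in
`cos θ`. -/
lemma exists_monic_sin_half (j : ℕ) :
    ∃ p : ℝ[X], p.Monic ∧ p.natDegree = j ∧
      ∀ θ : ℝ, sin ((j + 1 / 2) * θ) = 2 ^ j * (sin (θ / 2) * p.eval (cos θ)) := by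
  induction j using Nat.strong_induction_on with
  | _ j ih =>
    match j, ih with
    | 0, _ => exact ⟨1, monic_one, natDegree_one, fun θ => by simp; ring_nf⟩
    | 1, _ =>
      refine ⟨X + C (1 / 2), monic_X_add_C _, natDegree_X_add_C _, fun θ => ?_⟩
      have h : sin (((1 : ℕ) + 1 / 2) * θ) = sin (3 * (θ / 2)) := by congr 1; push_cast; ring
      have h' : cos θ = cos (2 * (θ / 2)) := by congr 1; ring
      rw [h, eval_add, eval_X, eval_C, h', sin_three_mul, cos_two_mul, cos_sq']
      ring
    | j + 2, ih =>
      obtain ⟨p, hp, hpd, hpe⟩ := ih j (by omega)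
      obtain ⟨q, hq, hqd, hqe⟩ := ih (j + 1) (by omega)
      have hXq : (X * q).Monic := monic_X.mul hq
      have hXd : (X * q).natDegree = j + 2 := by
        rw [natDegree_X_mul hq.ne_zero, hqd]
      have hCd : (C (1 / 4) * p).natDegree < (X * q).natDegree := by
        rw [hXd]
        exact (natDegree_C_mul_le _ _).trans_lt (by omega)
      refine ⟨X * q - C (1 / 4) * p, hXq.sub_of_left (degree_lt_degree hCd), ?_, fun θ => ?_⟩
      · rw [natDegree_sub_eq_left_of_natDegree_lt hCd, hXd]
      · have h₁ : sin (((j + 2 : ℕ) + 1 / 2) * θ)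
            = sin (((j + 1 : ℕ) + 1 / 2) * θ + θ) := by
          congr 1; push_cast; ring
        have h₂ : sin ((j + 1 / 2) * θ) = sin (((j + 1 : ℕ) + 1 / 2) * θ - θ) := by
          congr 1; push_cast; ring
        have h₃ := sin_add (((j + 1 : ℕ) + 1 / 2) * θ) θ
        have h₄ := sin_sub (((j + 1 : ℕ) + 1 / 2) * θ) θ
        have h₅ : sin (((j + 2 : ℕ) + 1 / 2) * θ)
            = 2 * cos θ * sin (((j + 1 : ℕ) + 1 / 2) * θ) - sin ((j + 1 / 2) * θ) := by
          rw [h₁, h₂, h₃, h₄]; ring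
        rw [h₅, hpe, hqe]
        simp only [eval_sub, eval_mul, eval_X, eval_C]
        ring

/-- The functions `θ ↦ √(2/π) sin ((j + 1/2) θ)`, orthonormal on `[0, π]`. -/
def sinBasis (j : ℕ) (θ : ℝ) : ℝ := √(2 / π) * sin ((j + 1 / 2) * θ)

@[fun_prop]
lemma continuous_sinBasis (j : ℕ) : Continuous (sinBasis j) := by
  unfold sinBasis; fun_prop

lemma integral_cos_int_mul (m : ℤ) :
    ∫ θ in Set.Icc (0 : ℝ) π, cos (m * θ) = if m = 0 then π else 0 := by
  rw [integral_Icc_eq_integral_Ioc, ← intervalIntegral.integral_of_le pi_pos.le]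
  split_ifs with h
  · simp [h]
  · have : (m : ℝ) ≠ 0 := by exact_mod_cast h
    rw [intervalIntegral.integral_comp_mul_left _ this]
    simp [sin_int_mul_pi]

lemma integral_sinBasis_mul (i j : ℕ) :
    ∫ θ in Set.Icc (0 : ℝ) π, sinBasis i θ * sinBasis j θ = if i = j then 1 else 0 := by
  have h : ∀ θ, sinBasis i θ * sinBasis j θ
      = π⁻¹ * (cos (((i - j : ℤ) : ℝ) * θ) - cos (((i + j + 1 : ℤ) : ℝ) * θ)) := by
    intro θ
    have hs : √(2 / π) * √(2 / π) = 2 * π⁻¹ := by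
      rw [Real.mul_self_sqrt (by positivity)]; rfl
    have h₁ : ((i - j : ℤ) : ℝ) * θ = (i + 1 / 2) * θ - (j + 1 / 2) * θ := by push_cast; ring
    have h₂ : ((i + j + 1 : ℤ) : ℝ) * θ = (i + 1 / 2) * θ + (j + 1 / 2) * θ := by
      push_cast; ring
    rw [h₁, h₂, cos_sub, cos_add]
    unfold sinBasis
    linear_combination (sin ((i + 1 / 2) * θ) * sin ((j + 1 / 2) * θ)) * hs
  simp_rw [h]
  rw [integral_const_mul, integral_sub, integral_cos_int_mul, integral_cos_int_mul,
    if_neg (by omega : ¬ ((i : ℤ) + j + 1 = 0))]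
  · by_cases hij : i = j
    · simp [hij]
    · rw [if_neg hij, if_neg (by omega)]; simp
  all_goals exact (by fun_prop : Continuous _).integrableOn_Icc

/-- The `SO(2N+1)` eigenangle density as a squared Slater determinant. -/
lemma densitySO_eq_det_sq (N : ℕ) (θ : Fin N → ℝ) :
    densitySO N θ = (N.factorial : ℝ)⁻¹ *
      (Matrix.of fun j k : Fin N => sinBasis j (θ k)).det ^ 2 := by
  choose p hpm hpd hpe using exists_monic_sin_half
  have hV := Matrix.det_eval_matrixOfPolynomials_eq_det_vandermonde (fun k => cos (θ k))
    (fun j : Fin N => p j) (fun j => hpd j) (fun j => hpm j)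
  have hM : (Matrix.of fun j k : Fin N => sinBasis j (θ k))
      = Matrix.of fun j k : Fin N => (√(2 / π) * 2 ^ (j : ℕ)) *
          (Matrix.of fun j k : Fin N => sin (θ k / 2) *
            (Matrix.of fun k j : Fin N => (p j).eval (cos (θ k))).transpose j k) j k := by
    ext j k
    simp only [Matrix.of_apply, Matrix.transpose_apply, sinBasis, hpe]
    ring
  rw [hM, Matrix.det_mul_column, Matrix.det_mul_row, Matrix.det_transpose, ← hV,
    Matrix.det_vandermonde, Finset.prod_mul_distrib, Finset.prod_const, Finset.card_univ,
    Fintype.card_fin, Finset.prod_pow_eq_pow_sum]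
  have hs : (√(2 / π) ^ N) ^ 2 = 2 ^ N / π ^ N := by
    rw [← pow_mul, mul_comm, pow_mul, Real.sq_sqrt (by positivity), div_pow]
  have h2 : ((2 : ℝ) ^ (∑ i : Fin N, (i : ℕ))) ^ 2 * 2 ^ N = 2 ^ (N ^ 2) := by
    rw [← pow_mul, ← pow_add, Fin.sum_univ_eq_sum_range (fun i => i) N,
      Finset.sum_range_id_mul_two]
    congr 1
    cases N with
    | zero => rfl
    | succ n => simp; ring
  have hfac : (N.factorial : ℝ) ≠ 0 := by positivity
  simp only [densitySO, Finset.prod_pow, mul_pow, hs]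
  rw [← h2]
  field_simp

/-- Integrating a function of a single variable against a squared Slater determinant of
orthonormal functions. -/
lemma integral_mul_det_sq {α ι : Type*} [MeasurableSpace α] [Fintype ι] [DecidableEq ι]
    (μ : Measure α) [SigmaFinite μ] (φ : ι → α → ℝ) (f : α → ℝ) (i₀ : ι)
    (hφ : ∀ i j, ∫ x, φ i x * φ j x ∂μ = if i = j then 1 else 0)
    (hint : ∀ i j, Integrable (fun x => φ i x * φ j x) μ)
    (hfint : ∀ i j, Integrable (fun x => f x * (φ i x * φ j x)) μ) :
    ∫ x : ι → α, f (x i₀) * (Matrix.of fun j k : ι => φ j (x k)).det ^ 2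
        ∂(Measure.pi fun _ => μ)
      = ∑ σ : Equiv.Perm ι, ∫ x, f x * (φ (σ i₀) x * φ (σ i₀) x) ∂μ := by
  set F : Equiv.Perm ι → Equiv.Perm ι → ι → α → ℝ := fun σ τ k x =>
    (if k = i₀ then f x else 1) * (φ (σ k) x * φ (τ k) x) with hF
  have hexp : ∀ x : ι → α, f (x i₀) * (Matrix.of fun j k : ι => φ j (x k)).det ^ 2
      = ∑ σ : Equiv.Perm ι, ∑ τ : Equiv.Perm ι,
        ((Equiv.Perm.sign σ : ℤ) : ℝ) * ((Equiv.Perm.sign τ : ℤ) : ℝ) *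
          ∏ k, F σ τ k (x k) := by
    intro x
    rw [Matrix.det_apply', sq, Finset.sum_mul_sum, Finset.mul_sum]
    refine Finset.sum_congr rfl fun σ _ => ?_
    rw [Finset.mul_sum]
    refine Finset.sum_congr rfl fun τ _ => ?_
    simp only [hF, Finset.prod_mul_distrib, Finset.prod_ite_eq', Finset.mem_univ, if_true,
      Matrix.of_apply]
    ring
  have hFint : ∀ σ τ k, Integrable (F σ τ k) μ := by
    intro σ τ k
    by_cases hk : k = i₀
    · simpa [hF, hk] using hfint (σ i₀) (τ i₀)
    · simpa [hF, hk] using hint (σ k) (τ k)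
  have hprod : ∀ σ τ, Integrable (fun x : ι → α => ∏ k, F σ τ k (x k))
      (Measure.pi fun _ => μ) := fun σ τ => Integrable.fintype_prod_dep (hFint σ τ)
  have hoff : ∀ σ τ : Equiv.Perm ι, ∀ k, k ≠ i₀ →
      ∫ x, F σ τ k x ∂μ = if σ k = τ k then 1 else 0 := by
    intro σ τ k hk
    simpa [hF, hk] using hφ (σ k) (τ k)
  simp_rw [hexp]
  rw [integral_finsetSum _ fun σ _ => integrable_finsetSum _ fun τ _ => (hprod σ τ).const_mul _]
  refine Finset.sum_congr rfl fun σ _ => ?_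
  rw [integral_finsetSum _ fun τ _ => (hprod σ τ).const_mul _, Finset.sum_eq_single σ]
  · rw [integral_const_mul, integral_fintype_prod_eq_prod,
      Finset.prod_eq_single i₀ (fun k _ hk => by rw [hoff σ σ k hk, if_pos rfl]) (by simp)]
    have hsign : ((Equiv.Perm.sign σ : ℤ) : ℝ) * ((Equiv.Perm.sign σ : ℤ) : ℝ) = 1 := by
      rw [← Int.cast_mul, ← Units.val_mul, Int.units_mul_self]; simp
    rw [hsign, one_mul]
    simp [hF]
  · intro τ _ hτ
    obtain ⟨k, hk, hne⟩ : ∃ k, k ≠ i₀ ∧ σ k ≠ τ k := by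
      by_contra! h
      have hmul : ∀ k, k ≠ i₀ → (τ⁻¹ * σ) k = k := fun k hk => by simp [h k hk]
      refine hτ (Eq.symm ?_)
      have h₀ : (τ⁻¹ * σ) i₀ = i₀ := by
        by_contra hne
        exact hne ((τ⁻¹ * σ).injective (hmul _ hne))
      have : τ⁻¹ * σ = 1 := Equiv.ext fun k => by
        by_cases hk : k = i₀
        · rw [hk, h₀]; rfl
        · rw [hmul k hk]; rfl
      exact (inv_mul_eq_one.mp this).symm
    rw [integral_const_mul, integral_fintype_prod_eq_prod,
      Finset.prod_eq_zero (Finset.mem_univ k) (by rw [hoff σ τ k hk, if_neg hne]), mul_zero]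
  · simp

lemma abs_sin_nat_mul_le (n : ℕ) (x : ℝ) : |sin (n * x)| ≤ n * |sin x| := by
  induction n with
  | zero => simp
  | succ n ih =>
    have h : ((n + 1 : ℕ) : ℝ) * x = n * x + x := by push_cast; ring
    rw [h, sin_add]
    calc |sin (n * x) * cos x + cos (n * x) * sin x|
        ≤ |sin (n * x)| * |cos x| + |cos (n * x)| * |sin x| := by
          rw [← abs_mul, ← abs_mul]; exact abs_add_le _ _
      _ ≤ n * |sin x| * 1 + 1 * |sin x| := by
          gcongr
          · exact abs_cos_le_one x
          · exact abs_cos_le_one _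
      _ = ((n + 1 : ℕ) : ℝ) * |sin x| := by push_cast; ring

lemma sinBasis_sq_le {N j : ℕ} (hj : j < N) (θ : ℝ) :
    sinBasis j θ * sinBasis j θ ≤ 8 * (N : ℝ) ^ 2 / π * sin (θ / 2) ^ 2 := by
  have h : |sin ((j + 1 / 2) * θ)| ≤ (2 * N) * |sin (θ / 2)| := by
    have h₁ : ((j : ℝ) + 1 / 2) * θ = ((2 * j + 1 : ℕ) : ℝ) * (θ / 2) := by push_cast; ring
    rw [h₁]
    refine (abs_sin_nat_mul_le _ _).trans ?_
    gcongr
    exact_mod_cast (by omega : 2 * j + 1 ≤ 2 * N)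
  have hsq : sin ((j + 1 / 2) * θ) ^ 2 ≤ (2 * N) ^ 2 * sin (θ / 2) ^ 2 := by
    rw [← sq_abs, ← sq_abs (sin (θ / 2)), ← mul_pow]
    gcongr
  calc sinBasis j θ * sinBasis j θ = 2 / π * sin ((j + 1 / 2) * θ) ^ 2 := by
        rw [← sq, sinBasis, mul_pow, Real.sq_sqrt (by positivity)]
    _ ≤ 2 / π * ((2 * N) ^ 2 * sin (θ / 2) ^ 2) := by gcongr
    _ = 8 * (N : ℝ) ^ 2 / π * sin (θ / 2) ^ 2 := by ring

lemma sq_add_sq_le_weight {s θ : ℝ} (hs0 : 0 ≤ s) (hs1 : s < 1) (hθ0 : 0 ≤ θ) (hθ : θ ≤ π) :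
    (1 - s) ^ 2 + θ ^ 2 ≤ 80 * ((1 - s) ^ 2 + 4 * s * sin (θ / 2) ^ 2) := by
  have hπ : π < 4 := by linarith [pi_lt_d2]
  rcases le_total (1 / 2) s with h | h
  · have hsin : 2 / π * (θ / 2) ≤ sin (θ / 2) := mul_le_sin (by linarith) (by linarith)
    have hle : θ / 4 ≤ sin (θ / 2) := by
      refine le_trans ?_ hsin
      rw [div_mul_div_comm, div_le_div_iff₀ (by norm_num) (by positivity)]
      nlinarith [pi_pos]
    have hsq : (θ / 4) ^ 2 ≤ sin (θ / 2) ^ 2 := by gcongr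
    nlinarith [sq_nonneg (1 - s), mul_nonneg (sub_nonneg.mpr h) (sq_nonneg (sin (θ / 2)))]
  · have h₁ : θ ^ 2 ≤ 16 := by nlinarith
    have h₂ : (1 / 4 : ℝ) ≤ (1 - s) ^ 2 := by nlinarith
    have h₃ : 0 ≤ 4 * s * sin (θ / 2) ^ 2 := by positivity
    nlinarith

lemma weight_pos {s : ℝ} (hs0 : 0 ≤ s) (hs1 : s < 1) (θ : ℝ) :
    0 < (1 - s) ^ 2 + 4 * s * sin (θ / 2) ^ 2 := by
  have : 0 < 1 - s := sub_pos.mpr hs1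
  positivity

lemma continuous_weight_sq_inv {s : ℝ} (hs0 : 0 ≤ s) (hs1 : s < 1) :
    Continuous fun θ : ℝ => (((1 - s) ^ 2 + 4 * s * sin (θ / 2) ^ 2) ^ 2)⁻¹ :=
  Continuous.inv₀ (by fun_prop) fun θ => (pow_pos (weight_pos hs0 hs1 θ) 2).ne'

lemma integral_weight_mul_sin_sq_le {s : ℝ} (hs0 : 0 ≤ s) (hs1 : s < 1) :
    ∫ θ in Set.Icc (0 : ℝ) π,
      (((1 - s) ^ 2 + 4 * s * sin (θ / 2) ^ 2) ^ 2)⁻¹ * sin (θ / 2) ^ 2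
      ≤ 800 * π / (1 - s) := by
  have ha : 0 < 1 - s := sub_pos.mpr hs1
  have hden : ∀ θ : ℝ, 0 < (1 - s) ^ 2 + θ ^ 2 := fun θ => by positivity
  calc ∫ θ in Set.Icc (0 : ℝ) π,
        (((1 - s) ^ 2 + 4 * s * sin (θ / 2) ^ 2) ^ 2)⁻¹ * sin (θ / 2) ^ 2
      ≤ ∫ θ in Set.Icc (0 : ℝ) π, 1600 * ((1 - s) ^ 2 + θ ^ 2)⁻¹ := by
        refine setIntegral_mono_on ?_ ?_ measurableSet_Icc fun θ hθ => ?_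
        · exact ((continuous_weight_sq_inv hs0 hs1).mul (by fun_prop)).integrableOn_Icc
        · exact (continuous_const.mul (Continuous.inv₀ (by fun_prop)
            fun θ => (hden θ).ne')).integrableOn_Icc
        · have hw := sq_add_sq_le_weight hs0 hs1 hθ.1 hθ.2
          have hsin : sin (θ / 2) ^ 2 ≤ (θ / 2) ^ 2 := by
            rw [← sq_abs, ← sq_abs (θ / 2)]
            exact pow_le_pow_left₀ (abs_nonneg _) abs_sin_le_abs 2
          have hd := hden θ
          calc (((1 - s) ^ 2 + 4 * s * sin (θ / 2) ^ 2) ^ 2)⁻¹ * sin (θ / 2) ^ 2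
              ≤ ((((1 - s) ^ 2 + θ ^ 2) / 80) ^ 2)⁻¹ * (((1 - s) ^ 2 + θ ^ 2) / 4) := by
                gcongr
                · linarith
                · nlinarith [sq_nonneg (1 - s)]
            _ = 1600 * ((1 - s) ^ 2 + θ ^ 2)⁻¹ := by field_simp; norm_num
    _ = 1600 * ((1 - s)⁻¹ * (arctan (π / (1 - s)) - arctan (0 / (1 - s)))) := by
        rw [integral_const_mul, integral_Icc_eq_integral_Ioc,
          ← intervalIntegral.integral_of_le pi_pos.le, integral_inv_sq_add_sq ha.ne']
    _ ≤ 1600 * ((1 - s)⁻¹ * (π / 2)) := by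
        gcongr
        simpa using (arctan_lt_pi_div_two _).le
    _ = 800 * π / (1 - s) := by ring

lemma densitySO_nonneg (N : ℕ) (θ : Fin N → ℝ) : 0 ≤ densitySO N θ := by
  rw [densitySO_eq_det_sq]; positivity

lemma restrict_pi_Icc (N : ℕ) :
    (volume : Measure (Fin N → ℝ)).restrict (Set.univ.pi fun _ => Set.Icc (0 : ℝ) π)
      = Measure.pi fun _ => volume.restrict (Set.Icc (0 : ℝ) π) := by
  rw [volume_pi, Measure.restrict_pi_pi]

lemma continuous_densitySO (N : ℕ) : Continuous (densitySO N) := by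
  unfold densitySO; fun_prop

lemma integral_weight_mul_densitySO_le {N : ℕ} {s : ℝ} (hs0 : 0 ≤ s) (hs1 : s < 1)
    (i₀ : Fin N) :
    ∫ θ in Set.univ.pi fun _ : Fin N => Set.Icc (0 : ℝ) π,
      (((1 - s) ^ 2 + 4 * s * sin (θ i₀ / 2) ^ 2) ^ 2)⁻¹ * densitySO N θ
      ≤ 6400 * (N : ℝ) ^ 2 / (1 - s) := by
  set f : ℝ → ℝ := fun t => (((1 - s) ^ 2 + 4 * s * sin (t / 2) ^ 2) ^ 2)⁻¹
  have hfc : Continuous f := continuous_weight_sq_inv hs0 hs1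
  have hf0 : ∀ t, 0 ≤ f t := fun t => by positivity
  have hbound : ∀ j : Fin N, ∫ t in Set.Icc (0 : ℝ) π, f t * (sinBasis j t * sinBasis j t)
      ≤ 6400 * (N : ℝ) ^ 2 / (1 - s) := by
    intro j
    calc ∫ t in Set.Icc (0 : ℝ) π, f t * (sinBasis j t * sinBasis j t)
        ≤ ∫ t in Set.Icc (0 : ℝ) π, 8 * (N : ℝ) ^ 2 / π * (f t * sin (t / 2) ^ 2) := by
          refine setIntegral_mono_on ?_ ?_ measurableSet_Icc fun t _ => ?_
          · exact (by fun_prop : Continuous _).integrableOn_Icc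
          · exact (by fun_prop : Continuous _).integrableOn_Icc
          · rw [mul_left_comm (8 * (N : ℝ) ^ 2 / π)]
            exact mul_le_mul_of_nonneg_left (sinBasis_sq_le j.isLt t) (hf0 t)
      _ ≤ 8 * (N : ℝ) ^ 2 / π * (800 * π / (1 - s)) := by
          rw [integral_const_mul]
          exact mul_le_mul_of_nonneg_left (integral_weight_mul_sin_sq_le hs0 hs1)
            (by positivity)
      _ = 6400 * (N : ℝ) ^ 2 / (1 - s) := by field_simp; ring
  have hperm := integral_mul_det_sq (volume.restrict (Set.Icc (0 : ℝ) π))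
    (fun j : Fin N => sinBasis j) f i₀
    (fun i j => by simp_rw [integral_sinBasis_mul, Fin.val_inj])
    (fun i j => (by fun_prop : Continuous _).integrableOn_Icc)
    (fun i j => (by fun_prop : Continuous _).integrableOn_Icc)
  have hfac : (0 : ℝ) < N.factorial := by positivity
  calc ∫ θ in Set.univ.pi fun _ : Fin N => Set.Icc (0 : ℝ) π, f (θ i₀) * densitySO N θ
      = (N.factorial : ℝ)⁻¹ * ∑ σ : Equiv.Perm (Fin N),
          ∫ t in Set.Icc (0 : ℝ) π, f t * (sinBasis (σ i₀) t * sinBasis (σ i₀) t) := by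
        rw [restrict_pi_Icc, ← hperm, ← integral_const_mul]
        refine integral_congr_ae (ae_of_all _ fun θ => ?_)
        simp only [densitySO_eq_det_sq]
        ring
    _ ≤ (N.factorial : ℝ)⁻¹ * ∑ _σ : Equiv.Perm (Fin N), 6400 * (N : ℝ) ^ 2 / (1 - s) := by
        gcongr with σ
        exact hbound (σ i₀)
    _ = 6400 * (N : ℝ) ^ 2 / (1 - s) := by
        rw [Finset.sum_const, Finset.card_univ, Fintype.card_perm, Fintype.card_fin,
          nsmul_eq_mul, inv_mul_cancel_left₀ hfac.ne']

/-- If every `w j` is at least `a ^ 2`, then all but two of the factors of `∏ (w j) ^ (-l j)`,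
both taken from an index with `2 ≤ l i₀`, may be replaced by `a ^ (-2)`. -/
lemma prod_zpow_neg_le {ι : Type*} [Fintype ι] [DecidableEq ι] {a : ℝ} (ha : 0 < a)
    (w : ι → ℝ) (hw : ∀ j, a ^ 2 ≤ w j) (l : ι → ℕ) (i₀ : ι) (hl : 2 ≤ l i₀) :
    ∏ j, w j ^ (-(l j : ℤ)) ≤ a ^ 4 / a ^ (2 * ∑ j, l j) * (w i₀ ^ 2)⁻¹ := by
  have hw0 : ∀ j, 0 < w j := fun j => (by positivity : 0 < a ^ 2).trans_le (hw j)
  calc ∏ j, w j ^ (-(l j : ℤ))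
      ≤ ∏ j, (if j = i₀ then a ^ 4 * (w j ^ 2)⁻¹ else 1) * (a ^ (2 * l j))⁻¹ := by
        refine Finset.prod_le_prod (fun j _ => (zpow_pos (hw0 j) _).le) fun j _ => ?_
        rw [zpow_neg, zpow_natCast]
        split_ifs with hj
        · subst hj
          obtain ⟨m, hm⟩ := Nat.exists_eq_add_of_le hl
          have hwj := hw0 j
          have hpow : (a ^ 2) ^ m ≤ w j ^ m := by gcongr; exact hw j
          have hrhs : a ^ 4 * (w j ^ 2)⁻¹ * (a ^ (2 * l j))⁻¹
              = (w j ^ 2 * (a ^ 2) ^ m)⁻¹ := by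
            rw [hm, mul_add, pow_add, pow_mul a 2 m]
            field_simp
          rw [hrhs, hm, pow_add]
          gcongr
        · rw [one_mul, pow_mul]
          gcongr
          exact hw j
    _ = a ^ 4 / a ^ (2 * ∑ j, l j) * (w i₀ ^ 2)⁻¹ := by
        rw [Finset.prod_mul_distrib, Finset.prod_ite_eq', if_pos (Finset.mem_univ _),
          Finset.prod_inv_distrib, Finset.prod_pow_eq_pow_sum, ← Finset.mul_sum]
        ring

/-- Bound on `g(l, s, N)` when some exponent `l_j` is at least `2`. -/
theorem gFun_bound_of_exists_two_le :
    ∃ C : ℝ, 0 < C ∧ ∀ (N : ℕ), 1 ≤ N → ∀ (s : ℝ), 0 ≤ s → s < 1 →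
      ∀ (n p : ℕ) (l : Fin N → ℕ), p + ∑ j, l j = n → (∃ j, 2 ≤ l j) →
        gFun N l s ≤ C * (N : ℝ) ^ 2 * (1 - s) ^ 3 / (1 - s) ^ (2 * n - 2 * p) := by
  refine ⟨6400, by norm_num, fun N _ s hs0 hs1 n p l hn hl => ?_⟩
  obtain ⟨i₀, hi₀⟩ := hl
  have ha : 0 < 1 - s := sub_pos.mpr hs1
  have hexp : 2 * n - 2 * p = 2 * ∑ j, l j := by omega
  set K : ℝ := (1 - s) ^ 4 / (1 - s) ^ (2 * ∑ j, l j) with hK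
  have hK0 : 0 ≤ K := by positivity
  calc gFun N l s
      ≤ ∫ θ in Set.univ.pi fun _ : Fin N => Set.Icc (0 : ℝ) π,
          K * ((((1 - s) ^ 2 + 4 * s * sin (θ i₀ / 2) ^ 2) ^ 2)⁻¹ * densitySO N θ) := by
        refine integral_mono_of_nonneg (ae_of_all _ fun θ => ?_) ?_ (ae_of_all _ fun θ => ?_)
        · exact mul_nonneg (Finset.prod_nonneg fun j _ =>
            (zpow_pos (weight_pos hs0 hs1 (θ j)) _).le) (densitySO_nonneg N θ)
        · refine ContinuousOn.integrableOn_compact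
            (isCompact_univ_pi fun _ => isCompact_Icc) (Continuous.continuousOn ?_)
          exact continuous_const.mul (((continuous_weight_sq_inv hs0 hs1).comp
            (continuous_apply i₀)).mul (continuous_densitySO N))
        · beta_reduce
          rw [← mul_assoc]
          refine mul_le_mul_of_nonneg_right ?_ (densitySO_nonneg N θ)
          refine prod_zpow_neg_le ha (fun j => (1 - s) ^ 2 + 4 * s * sin (θ j / 2) ^ 2)
            (fun j => ?_) l i₀ hi₀
          have : 0 ≤ 4 * s * sin (θ j / 2) ^ 2 := by positivity
          linarith
    _ ≤ K * (6400 * (N : ℝ) ^ 2 / (1 - s)) := by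
        rw [integral_const_mul]
        exact mul_le_mul_of_nonneg_left (integral_weight_mul_densitySO_le hs0 hs1 i₀) hK0
    _ = 6400 * (N : ℝ) ^ 2 * (1 - s) ^ 3 / (1 - s) ^ (2 * n - 2 * p) := by
        rw [hexp, hK]
        field_simp
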